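/- (Trainability of the re-parameterized Bernstein layer.) Let l < u be real numbers, n ≥ 1 a natural number, δ > 0, c_0 ∈ ℝ, and ρ_0, …, ρ_{n−1} ∈ ℝ. Define c_k = c_0 + Σ_{j=0}^{k−1} (log(1 + e^{ρ_j}) + δ) for k ∈ {1,…,n}, and let σ be the Bernstein activation on [l,u] with coefficients c_0,…,c_n. Then for every x ∈ [l,u], σ'(x) ≥ n·δ/(u−l) > 0; hence the re-parameterized layer satisfies the gradient lower bound throughout training. -/

import Mathlib

/-- The Bernstein basis polynomial of degree `n`, index `k`, on the interval `[l, u]`. -/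
noncomputable def bernBasis (l u : ℝ) (n k : ℕ) (x : ℝ) : ℝ :=
  (n.choose k : ℝ) / (u - l) ^ n * (x - l) ^ k * (u - x) ^ (n - k)

/-- The Bernstein activation with coefficients `c 0, …, c n` on `[l, u]`. -/
noncomputable def bernAct (l u : ℝ) (n : ℕ) (c : ℕ → ℝ) (x : ℝ) : ℝ :=
  ∑ k ∈ Finset.range (n + 1), c k * bernBasis l u n k x

theorem bernBasis_eq_zero_of_lt (l u : ℝ) {n k : ℕ} (h : n < k) (x : ℝ) :
    bernBasis l u n k x = 0 := by
  simp [bernBasis, Nat.choose_eq_zero_of_lt h]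

theorem bernBasis_nonneg {l u x : ℝ} (hx : x ∈ Set.Icc l u) (n k : ℕ) :
    0 ≤ bernBasis l u n k x := by
  have h₁ : 0 ≤ x - l := sub_nonneg.2 hx.1
  have h₂ : 0 ≤ u - x := sub_nonneg.2 hx.2
  have h₃ : 0 ≤ u - l := sub_nonneg.2 (hx.1.trans hx.2)
  unfold bernBasis
  positivity

/-- The Bernstein basis is a partition of unity. -/
theorem sum_bernBasis {l u : ℝ} (hlu : l ≠ u) (n : ℕ) (x : ℝ) :
    ∑ k ∈ Finset.range (n + 1), bernBasis l u n k x = 1 := by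
  have h : (u - l) ^ n ≠ 0 := pow_ne_zero _ (sub_ne_zero.2 hlu.symm)
  have key := add_pow (x - l) (u - x) n
  rw [show x - l + (u - x) = u - l by ring] at key
  rw [← div_self h, congrArg (· / (u - l) ^ n) key, Finset.sum_div]
  refine Finset.sum_congr rfl fun k _ => ?_
  unfold bernBasis
  ring

theorem hasDerivAt_bernBasis_zero (l u : ℝ) (n : ℕ) (x : ℝ) :
    HasDerivAt (bernBasis l u (n + 1) 0)
      (-((n + 1) / (u - l) * bernBasis l u n 0 x)) x := by
  have h₁ := (((hasDerivAt_id x).const_sub u).pow (n + 1)).const_mul (1 / (u - l) ^ (n + 1))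
  refine HasDerivAt.congr_of_eventuallyEq (h₁.congr_deriv ?_) (.of_forall fun y => ?_)
  rotate_left
  · simp [bernBasis]
  · simp [bernBasis]
    generalize u - l = d
    ring

theorem hasDerivAt_bernBasis_succ (l u : ℝ) (n k : ℕ) (x : ℝ) :
    HasDerivAt (bernBasis l u (n + 1) (k + 1))
      ((n + 1) / (u - l) * (bernBasis l u n k x - bernBasis l u n (k + 1) x)) x := by
  have h₁ := ((((hasDerivAt_id x).sub_const l).pow (k + 1)).const_mul
    (((n + 1).choose (k + 1) : ℝ) / (u - l) ^ (n + 1))).mul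
    (((hasDerivAt_id x).const_sub u).pow (n - k))
  have e₁ : ((n + 1).choose (k + 1) : ℝ) * (k + 1) = (n + 1) * n.choose k := by
    exact_mod_cast (Nat.add_one_mul_choose_eq n k).symm
  have e₂ : (n.choose (k + 1) : ℝ) * (k + 1) = n.choose k * (n - k : ℕ) := by
    exact_mod_cast Nat.choose_succ_right_eq n k
  have e₃ : ((n + 1).choose (k + 1) : ℝ) * (n - k : ℕ) = (n + 1) * n.choose (k + 1) := by
    have hk' : (k + 1 : ℝ) ≠ 0 := by positivity
    apply mul_right_cancel₀ hk'
    linear_combination ((n - k : ℕ) : ℝ) * e₁ - (n + 1) * e₂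
  refine HasDerivAt.congr_of_eventuallyEq (h₁.congr_deriv ?_) (.of_forall fun y => ?_)
  rotate_left
  · simp [bernBasis]
  · simp only [bernBasis, id, Pi.pow_apply, Nat.add_sub_cancel, Nat.cast_add,
      Nat.cast_one, ← Nat.sub_sub]
    generalize u - l = d
    linear_combination (d ^ (n + 1))⁻¹ * ((x - l) ^ k * (u - x) ^ (n - k) * e₁ -
      (x - l) ^ (k + 1) * (u - x) ^ (n - k - 1) * e₃)

/-- The derivative of a Bernstein activation is the Bernstein activation of one degree less whose
coefficients are the scaled forward differences. -/
theorem hasDerivAt_bernAct (l u : ℝ) (n : ℕ) (c : ℕ → ℝ) (x : ℝ) :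
    HasDerivAt (bernAct l u (n + 1) c)
      ((n + 1) / (u - l) * bernAct l u n (fun k => c (k + 1) - c k) x) x := by
  have h₁ : HasDerivAt
      (fun y => ∑ k ∈ Finset.range (n + 1), c (k + 1) * bernBasis l u (n + 1) (k + 1) y +
        c 0 * bernBasis l u (n + 1) 0 y) _ x :=
    (HasDerivAt.fun_sum fun k _ =>
      (hasDerivAt_bernBasis_succ l u n k x).const_mul (c (k + 1))).add
      ((hasDerivAt_bernBasis_zero l u n x).const_mul (c 0))
  refine HasDerivAt.congr_of_eventuallyEq (h₁.congr_deriv ?_) (.of_forall fun y => ?_)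
  rotate_left
  · exact Finset.sum_range_succ' _ _
  · have shift : ∑ k ∈ Finset.range (n + 1), c (k + 1) * bernBasis l u n (k + 1) x +
        c 0 * bernBasis l u n 0 x = ∑ k ∈ Finset.range (n + 1), c k * bernBasis l u n k x := by
      rw [← Finset.sum_range_succ' (fun k => c k * bernBasis l u n k x), Finset.sum_range_succ,
        bernBasis_eq_zero_of_lt l u n.lt_succ_self, mul_zero, add_zero]
    simp only [bernAct, sub_mul, Finset.sum_sub_distrib, mul_left_comm (c _), ← Finset.mul_sum,
      mul_sub, mul_neg]
    linear_combination -((n + 1) / (u - l)) * shift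

/-- A lower bound on the coefficients bounds a Bernstein activation from below on `[l, u]`. -/
theorem le_bernAct {l u x δ : ℝ} (hlu : l ≠ u) (hx : x ∈ Set.Icc l u) {n : ℕ} {c : ℕ → ℝ}
    (hc : ∀ k ≤ n, δ ≤ c k) : δ ≤ bernAct l u n c x := by
  calc δ = ∑ k ∈ Finset.range (n + 1), δ * bernBasis l u n k x := by
        rw [← Finset.mul_sum, sum_bernBasis hlu, mul_one]
    _ ≤ _ := Finset.sum_le_sum fun k hk => mul_le_mul_of_nonneg_right
        (hc k (Nat.lt_succ_iff.1 (Finset.mem_range.1 hk))) (bernBasis_nonneg hx n k)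

/-- Trainability of the re-parameterized Bernstein layer: with
`c k = c 0 + Σ_{j<k} (log (1 + e^{ρ j}) + δ)`, the Bernstein activation with these
coefficients satisfies `σ'(x) ≥ nδ/(u−l) > 0` for every `x ∈ [l,u]`. -/
theorem reparam_layer_gradient_lower_bound (l u : ℝ) (hlu : l < u) (n : ℕ) (hn : 1 ≤ n)
    (δ : ℝ) (hδ : 0 < δ) (c0 : ℝ) (ρ : ℕ → ℝ) (c : ℕ → ℝ)
    (hc : ∀ k, c k = c0 + ∑ j ∈ Finset.range k, (Real.log (1 + Real.exp (ρ j)) + δ)) :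
    ∀ x ∈ Set.Icc l u,
      n * δ / (u - l) ≤ deriv (bernAct l u n c) x ∧ 0 < n * δ / (u - l) := by
  intro x hx
  have hul : 0 < u - l := sub_pos.2 hlu
  obtain ⟨m, rfl⟩ := Nat.exists_eq_add_of_le' hn
  refine ⟨?_, by positivity⟩
  rw [(hasDerivAt_bernAct l u m c x).deriv, Nat.cast_add_one, mul_div_right_comm]
  refine mul_le_mul_of_nonneg_left (le_bernAct hlu.ne hx fun k _ => ?_) (by positivity)
  have hlog : 0 ≤ Real.log (1 + Real.exp (ρ k)) :=
    Real.log_nonneg (by linarith [Real.exp_pos (ρ k)])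
  rw [hc, hc, Finset.sum_range_succ]
  linarith
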